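/- Every equatorial graph is regular: if G is an equatorial graph with minimum degree δ, then every vertex of G has degree exactly δ. -/

import Mathlib

open SimpleGraph

/-- The distance between two indices around a cycle of length `q`. -/
def cycleDist {q : ℕ} (i j : ZMod q) : ℕ := min (i - j).val (j - i).val

/-- `f` lists the vertices (in cyclic order) of an isometric cycle of length `q` in `G`:
the distance in `G` between any two of its vertices equals their distance along the cycle. -/
def IsIsoCycle {V : Type*} (G : SimpleGraph V) (q : ℕ) (f : ZMod q → V) : Prop :=
  3 ≤ q ∧ ∀ i j : ZMod q, G.dist (f i) (f j) = cycleDist i j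

/-- `G` has an isometric cycle of length `q`. -/
def HasIsoCycle {V : Type*} (G : SimpleGraph V) (q : ℕ) : Prop :=
  ∃ f : ZMod q → V, IsIsoCycle G q f

/-- The equator of `G` is `q`: `q` is the length of a longest isometric cycle of `G`
(`0` if `G` has no isometric cycle, e.g. if `G` is acyclic). -/
def IsEquator {V : Type*} (G : SimpleGraph V) (q : ℕ) : Prop :=
  (HasIsoCycle G q ∨ (q = 0 ∧ ∀ q', ¬ HasIsoCycle G q')) ∧ ∀ q', HasIsoCycle G q' → q' ≤ q

/-- The degree of a vertex, as the cardinality of its neighbor set. -/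
noncomputable def ndeg {V : Type*} (G : SimpleGraph V) (v : V) : ℕ := (G.neighborSet v).ncard

/-- `G` has minimum degree `δ`. -/
def HasMinDegree {V : Type*} (G : SimpleGraph V) (δ : ℕ) : Prop :=
  (∀ v, δ ≤ ndeg G v) ∧ ∃ v, ndeg G v = δ

/-- The Moore bound `M(δ, g)`. -/
def mooreBound (δ g : ℕ) : ℕ :=
  if Odd g then 1 + δ * ∑ i ∈ Finset.range ((g + 1) / 2 - 1), (δ - 1) ^ i
  else 2 + ∑ i ∈ Finset.Icc 1 ((g + 1) / 2 - 1), 2 * (δ - 1) ^ i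

/-- The disk of radius `k` around a vertex `u`. -/
def disk {V : Type*} (G : SimpleGraph V) (k : ℕ) (u : V) : Set V := {v | G.dist u v ≤ k}

/-- The disk of radius `k` around an edge `uv`. -/
def edisk {V : Type*} (G : SimpleGraph V) (k : ℕ) (u v : V) : Set V :=
  disk G k u ∪ disk G k v

/-- `G` is an equatorial graph with minimum degree `δ`, girth `g` and equator `q`:
a finite connected simple graph with girth `g`, minimum degree `δ`, equator `q > 6k + 3`
(where `k = ⌈g/2⌉ - 1`) whose order attains the bound `n = (q/g) · M(δ, g)`. -/
def IsEquatorial {V : Type*} (G : SimpleGraph V) (δ g q : ℕ) : Prop :=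
  Finite V ∧ G.Connected ∧ G.girth = g ∧ HasMinDegree G δ ∧ IsEquator G q ∧
    6 * ((g + 1) / 2 - 1) + 3 < q ∧ g * Nat.card V = q * mooreBound δ g

/-- The part `L i` of the partition induced by the isometric cycle `f`:
`L i = D_k(u_{i-k}) ∩ D_k(u_{i+k})`. -/
def Lpart {V : Type*} (G : SimpleGraph V) (k : ℕ) {q : ℕ} (f : ZMod q → V) (i : ZMod q) :
    Set V :=
  disk G k (f (i - (k : ZMod q))) ∩ disk G k (f (i + (k : ZMod q)))

namespace SimpleGraph

variable {V : Type*} {G : SimpleGraph V}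

/-- Two distinct paths with common ends span a cycle, so their total length is at least the
girth. -/
theorem girth_le_length_add_length_of_ne {a b : V} {p r : G.Walk a b} (hp : p.IsPath)
    (hr : r.IsPath) (hne : p ≠ r) : G.girth ≤ p.length + r.length := by
  classical
  by_contra! hlt
  set H : SimpleGraph V := fromEdgeSet {e | e ∈ p.edges ++ r.edges} with hH
  have hHe : ∀ e, e ∈ H.edgeSet ↔ e ∈ p.edges ++ r.edges := by
    intro e
    rw [hH, edgeSet_fromEdgeSet]
    constructor
    · exact fun h => h.1
    · intro h
      refine ⟨h, fun hd => ?_⟩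
      have hG : e ∈ G.edgeSet := by
        rcases List.mem_append.1 h with h | h
        exacts [p.edges_subset_edgeSet h, r.edges_subset_edgeSet h]
      exact G.not_isDiag_of_mem_edgeSet hG hd
  have hac : H.IsAcyclic := by
    intro v c hc
    have hce : ∀ e ∈ c.edges, e ∈ p.edges ++ r.edges := fun e he =>
      (hHe e).1 (c.edges_subset_edgeSet he)
    have hcG : ∀ e ∈ c.edges, e ∈ G.edgeSet := fun e he => by
      rcases List.mem_append.1 (hce e he) with h | h
      exacts [p.edges_subset_edgeSet h, r.edges_subset_edgeSet h]
    have h₁ := girth_le_length (hc.transfer hcG)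
    have h₂ := (hc.edges_nodup.subperm (fun e he => hce e he)).length_le
    simp only [List.length_append, Walk.length_edges, Walk.length_transfer] at h₁ h₂
    omega
  have hpH : ∀ e ∈ p.edges, e ∈ H.edgeSet := fun e he =>
    (hHe e).2 (List.mem_append_left _ he)
  have hrH : ∀ e ∈ r.edges, e ∈ H.edgeSet := fun e he =>
    (hHe e).2 (List.mem_append_right _ he)
  have heq := (hac.subsingleton_path a b).elim ⟨_, hp.transfer hpH⟩ ⟨_, hr.transfer hrH⟩
  have hs := congrArg (fun w : H.Path a b => w.1.support) heq
  simp only [Walk.support_transfer] at hs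
  exact hne (Walk.ext_support hs)

/-- If a vertex `w` has two neighbours `u ≠ z`, with `z` closer to `x` than `w` and `u` not
further from `x` than `w`, then `w` and `x` lie on a short cycle. -/
theorem Connected.girth_le_of_adj_of_adj (hG : G.Connected) {u w z x : V} (hwu : G.Adj w u)
    (hwz : G.Adj w z) (huz : u ≠ z) (hz : G.dist w x = G.dist z x + 1)
    (hu : G.dist u x ≤ G.dist w x) : G.girth ≤ G.dist u x + G.dist z x + 2 := by
  classical
  obtain ⟨p, hp, hpl⟩ := hG.exists_path_of_dist u x
  obtain ⟨r, hr, hrl⟩ := hG.exists_path_of_dist z x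
  have hwp : w ∉ p.support := by
    intro hw
    have h₁ := dist_le (p.dropUntil w hw)
    have h₂ := congrArg Walk.length (p.take_spec hw)
    rw [Walk.length_append] at h₂
    have h₃ : (p.takeUntil w hw).length = 0 := by omega
    exact hwu.ne (Walk.eq_of_length_eq_zero h₃).symm
  have hwr : w ∉ r.support := by
    intro hw
    have h₁ := dist_le (r.dropUntil w hw)
    have h₂ := congrArg Walk.length (r.take_spec hw)
    rw [Walk.length_append] at h₂
    omega
  have hne : Walk.cons hwu p ≠ Walk.cons hwz r := by
    intro h
    exact huz (Walk.cons.inj h).1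
  have := girth_le_length_add_length_of_ne (hp.cons hwp) (hr.cons hwr) hne
  simp only [Walk.length_cons] at this
  omega

section Branch

variable [Fintype V]

open scoped Classical in
/-- The vertices at distance `j` from `w` and at distance `j + 1` from `u`. -/
noncomputable def branch (G : SimpleGraph V) (u w : V) (j : ℕ) : Finset V :=
  {x | G.dist w x = j ∧ G.dist u x = j + 1}

@[simp]
theorem mem_branch {u w x : V} {j : ℕ} :
    x ∈ G.branch u w j ↔ G.dist w x = j ∧ G.dist u x = j + 1 := by
  simp [branch]

theorem Connected.pairwiseDisjoint_branch (hG : G.Connected) (w : V) {j : ℕ}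
    (hj : 2 * j + 2 < G.girth) : (G.neighborSet w).PairwiseDisjoint (G.branch w · j) := by
  intro u hu z hz huz
  rw [Function.onFun, Finset.disjoint_left]
  intro x hxu hxz
  rw [mem_branch] at hxu hxz
  have := hG.girth_le_of_adj_of_adj hu hz huz (x := x) (by omega) (by omega)
  omega

theorem Connected.card_mul_le_card_biUnion_branch [DecidableEq V] (hG : G.Connected) {w : V}
    {s : Finset V} (hs : ∀ z ∈ s, G.Adj w z) {j m : ℕ} (hj : 2 * j + 2 < G.girth)
    (hm : ∀ z, G.Adj w z → m ≤ (G.branch w z j).card) :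
    s.card * m ≤ (s.biUnion (G.branch w · j)).card := by
  rw [Finset.card_biUnion fun u hu z hz huz =>
    hG.pairwiseDisjoint_branch w hj (hs u hu) (hs z hz) huz, ← smul_eq_mul]
  exact Finset.card_nsmul_le_sum _ _ _ fun z hz => hm z (hs z hz)

theorem Connected.card_branch_succ (hG : G.Connected) {u w : V} (hwu : G.Adj w u) {j m : ℕ}
    (hj : 2 * j + 3 < G.girth) (hm : ∀ z, G.Adj w z → m ≤ (G.branch w z j).card) :
    (ndeg G w - 1) * m ≤ (G.branch u w (j + 1)).card := by
  classical
  set s := (G.neighborSet w).toFinset.erase u with hs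
  have hcard : ndeg G w - 1 = s.card := by
    rw [hs, Finset.card_erase_of_mem (by simpa using hwu), ndeg, Set.ncard_eq_toFinset_card']
  have hadj : ∀ z ∈ s, G.Adj w z := fun z hz => by
    simpa using Finset.mem_of_mem_erase hz
  rw [hcard]
  refine (hG.card_mul_le_card_biUnion_branch hadj (by omega) hm).trans
    (Finset.card_le_card fun x hx => ?_)
  obtain ⟨z, hz, hxz⟩ := Finset.mem_biUnion.1 hx
  rw [mem_branch] at hxz ⊢
  refine ⟨hxz.2, ?_⟩
  have h₁ : G.dist u x ≤ G.dist u w + G.dist w x := hG.dist_triangle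
  rw [dist_eq_one_iff_adj.2 hwu.symm] at h₁
  by_contra hne
  have := hG.girth_le_of_adj_of_adj hwu (hadj z hz) (Finset.ne_of_mem_erase hz).symm (x := x)
    (by omega) (by omega)
  omega

theorem Connected.pow_le_card_branch (hG : G.Connected) {δ : ℕ} (hδ : ∀ v, δ ≤ ndeg G v) (j : ℕ)
    (hj : 2 * j + 1 < G.girth) {u w : V} (hwu : G.Adj w u) :
    (δ - 1) ^ j ≤ (G.branch u w j).card := by
  induction j generalizing u w with
  | zero =>
    have : w ∈ G.branch u w 0 := by
      simpa using dist_eq_one_iff_adj.2 hwu.symm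
    simpa using Finset.card_pos.2 ⟨w, this⟩
  | succ j ih =>
    refine le_trans ?_ (hG.card_branch_succ hwu (j := j) (by omega) fun z hz =>
      ih (by omega) hz.symm)
    rw [pow_succ']
    exact Nat.mul_le_mul_right _ (Nat.sub_le_sub_right (hδ w) 1)

/-- The vertex form of the Moore bound, in terms of the degree of the centre. -/
theorem Connected.moore_le_ncard_disk (hG : G.Connected) {δ : ℕ} (hδ : ∀ v, δ ≤ ndeg G v) {k : ℕ}
    (hk : 2 * k < G.girth) (u : V) :
    1 + ndeg G u * ∑ i ∈ Finset.range k, (δ - 1) ^ i ≤ (disk G k u).ncard := by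
  classical
  have hN : ndeg G u = (G.neighborSet u).toFinset.card := by
    rw [ndeg, Set.ncard_eq_toFinset_card']
  set N := (G.neighborSet u).toFinset with hNdef
  have hadj : ∀ z ∈ N, G.Adj u z := fun z hz => by simpa [hNdef] using hz
  let L : ℕ → Finset V := fun j => N.biUnion (G.branch u · j)
  have hL : ∀ j, ∀ x ∈ L j, G.dist u x = j + 1 := by
    intro j x hx
    obtain ⟨z, _, hxz⟩ := Finset.mem_biUnion.1 hx
    exact (mem_branch.1 hxz).2
  have hdisj : ((Finset.range k : Finset ℕ) : Set ℕ).PairwiseDisjoint L := by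
    intro i _ j _ hij
    rw [Function.onFun, Finset.disjoint_left]
    intro x hi hj
    have := hL i x hi
    have := hL j x hj
    omega
  have hu : u ∉ (Finset.range k).biUnion L := by
    intro h
    obtain ⟨j, _, hj⟩ := Finset.mem_biUnion.1 h
    simpa using hL j u hj
  have hsub : ((insert u ((Finset.range k).biUnion L) : Finset V) : Set V) ⊆ disk G k u := by
    intro x hx
    rcases Finset.mem_insert.1 (Finset.mem_coe.1 hx) with rfl | hx
    · simp [disk]
    · obtain ⟨j, hjk, hj⟩ := Finset.mem_biUnion.1 hx
      have h₁ := hL j x hj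
      have h₂ := Finset.mem_range.1 hjk
      simp only [disk, Set.mem_ofPred_eq]
      omega
  have hle := Set.ncard_le_ncard hsub (Set.toFinite _)
  rw [Set.ncard_coe_finset, Finset.card_insert_of_notMem hu, Finset.card_biUnion hdisj] at hle
  refine le_trans ?_ hle
  rw [add_comm, Finset.mul_sum, hN]
  refine Nat.add_le_add_right (Finset.sum_le_sum fun j hj => ?_) 1
  have hjk := Finset.mem_range.1 hj
  exact hG.card_mul_le_card_biUnion_branch hadj (by omega) fun z hz =>
    hG.pow_le_card_branch hδ j (by omega) hz.symm

theorem Connected.one_add_le_sum_card_branch (hG : G.Connected) {δ : ℕ} (hδ : ∀ v, δ ≤ ndeg G v)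
    {k : ℕ} (hk : 2 * k + 1 < G.girth) {u w : V} (hwu : G.Adj w u) :
    1 + (ndeg G w - 1) * ∑ i ∈ Finset.range k, (δ - 1) ^ i ≤
      ∑ j ∈ Finset.range (k + 1), (G.branch u w j).card := by
  rw [Finset.sum_range_succ', add_comm, Finset.mul_sum]
  refine Nat.add_le_add (Finset.sum_le_sum fun j hj => ?_) ?_
  · have hjk := Finset.mem_range.1 hj
    exact hG.card_branch_succ hwu (by omega) fun z hz =>
      hG.pow_le_card_branch hδ j (by omega) hz.symm
  · simpa using hG.pow_le_card_branch hδ 0 (by omega) hwu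

/-- The edge form of the Moore bound, in terms of the degrees of the two central vertices. -/
theorem Connected.moore_le_ncard_edisk (hG : G.Connected) {δ : ℕ} (hδ : ∀ v, δ ≤ ndeg G v) {k : ℕ}
    (hk : 2 * k + 1 < G.girth) {u v : V} (huv : G.Adj u v) :
    2 + ((ndeg G u - 1) + (ndeg G v - 1)) * ∑ i ∈ Finset.range k, (δ - 1) ^ i ≤
      (edisk G k u v).ncard := by
  classical
  let B : V → V → Finset V := fun a b => (Finset.range (k + 1)).biUnion (G.branch a b)
  have hB : ∀ a b x, x ∈ B a b ↔ G.dist b x ≤ k ∧ G.dist a x = G.dist b x + 1 := by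
    intro a b x
    simp only [B, Finset.mem_biUnion, Finset.mem_range, mem_branch]
    constructor
    · rintro ⟨j, hj, hb, ha⟩
      omega
    · rintro ⟨hb, ha⟩
      exact ⟨_, by omega, rfl, ha⟩
  have hcard : ∀ a b, (B a b).card = ∑ j ∈ Finset.range (k + 1), (G.branch a b j).card := by
    intro a b
    refine Finset.card_biUnion fun i _ j _ hij => ?_
    rw [Function.onFun, Finset.disjoint_left]
    intro x hi hj
    rw [mem_branch] at hi hj
    omega
  have hdisj : Disjoint (B v u) (B u v) := by
    rw [Finset.disjoint_left]
    intro x h₁ h₂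
    rw [hB] at h₁ h₂
    omega
  have hsub : ((B v u ∪ B u v : Finset V) : Set V) ⊆ edisk G k u v := by
    intro x hx
    rcases Finset.mem_union.1 (Finset.mem_coe.1 hx) with hx | hx
    · exact Or.inl ((hB _ _ _).1 hx).1
    · exact Or.inr ((hB _ _ _).1 hx).1
  have hle := Set.ncard_le_ncard hsub (Set.toFinite _)
  rw [Set.ncard_coe_finset, Finset.card_union_of_disjoint hdisj, hcard, hcard] at hle
  have h₁ := hG.one_add_le_sum_card_branch hδ hk huv
  have h₂ := hG.one_add_le_sum_card_branch hδ hk huv.symm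
  rw [add_mul]
  omega

end Branch

end SimpleGraph

section CyclicDistance

variable {q : ℕ}

theorem ZMod.eq_of_intCast_eq_of_sub_lt {s t : ℤ} (h : (s : ZMod q) = t) (h₁ : s - t < q)
    (h₂ : t - s < q) : s = t := by
  rw [ZMod.intCast_eq_intCast_iff_dvd_sub] at h
  have := Int.eq_zero_of_abs_lt_dvd h (abs_lt.2 ⟨by omega, by omega⟩)
  omega

theorem cycleDist_le_iff [NeZero q] {i j : ZMod q} {n : ℕ} :
    cycleDist i j ≤ n ↔ ∃ t : ℤ, -n ≤ t ∧ t ≤ n ∧ j = i + t := by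
  rw [cycleDist, min_le_iff]
  constructor
  · rintro (h | h)
    · refine ⟨-((i - j).val : ℤ), by omega, by omega, ?_⟩
      push_cast
      rw [ZMod.natCast_zmod_val]
      ring
    · refine ⟨((j - i).val : ℤ), by omega, by omega, ?_⟩
      push_cast
      rw [ZMod.natCast_zmod_val]
      ring
  · rintro ⟨t, h₁, h₂, rfl⟩
    rcases le_total 0 t with ht | ht
    · right
      lift t to ℕ using ht
      simp only [Int.cast_natCast, add_sub_cancel_left, ZMod.val_natCast]
      exact (Nat.mod_le _ _).trans (by omega)
    · left
      obtain ⟨m, rfl⟩ : ∃ m : ℕ, t = -m := ⟨t.natAbs, by omega⟩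
      have : i - (i + ((-(m : ℤ) : ℤ) : ZMod q)) = (m : ZMod q) := by push_cast; ring
      rw [this, ZMod.val_natCast]
      exact (Nat.mod_le _ _).trans (by omega)

/-- The `m + 1` consecutive residues starting at `b`. -/
def cyclicArc (b : ZMod q) (m : ℕ) : Set (ZMod q) :=
  (fun r : ℤ => b + (r : ZMod q)) '' (Finset.Icc (0 : ℤ) m : Set ℤ)

theorem mem_cyclicArc {b x : ZMod q} {m : ℕ} :
    x ∈ cyclicArc b m ↔ ∃ r : ℤ, 0 ≤ r ∧ r ≤ m ∧ x = b + r := by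
  simp only [cyclicArc, Set.mem_image, Finset.coe_Icc, Set.mem_Icc, and_assoc]
  exact ⟨fun ⟨r, h₁, h₂, h⟩ => ⟨r, h₁, h₂, h.symm⟩, fun ⟨r, h₁, h₂, h⟩ => ⟨r, h₁, h₂, h.symm⟩⟩

theorem ncard_cyclicArc_le (b : ZMod q) (m : ℕ) : (cyclicArc b m).ncard ≤ m + 1 := by
  refine (Set.ncard_image_le (Finset.finite_toSet _)).trans ?_
  rw [Set.ncard_coe_finset, Int.card_Icc]
  omega

theorem finite_cyclicArc (b : ZMod q) (m : ℕ) : (cyclicArc b m).Finite :=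
  (Finset.finite_toSet _).image _

/-- Residues at pairwise cyclic distance at most `m`, where `3 * m < q`, lie on a short arc. -/
theorem exists_subset_cyclicArc [NeZero q] {m : ℕ} (hm : 3 * m < q) {S : Set (ZMod q)}
    (hS : ∀ i ∈ S, ∀ j ∈ S, cycleDist i j ≤ m) : ∃ a, S ⊆ cyclicArc a m := by
  classical
  rcases S.eq_empty_or_nonempty with rfl | ⟨i₀, hi₀⟩
  · exact ⟨0, Set.empty_subset _⟩
  set T : Finset ℤ := {t ∈ Finset.Icc (-(m : ℤ)) m | i₀ + (t : ZMod q) ∈ S} with hT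
  have hT0 : T.Nonempty := ⟨0, by simp [hT, hi₀]⟩
  have hmin := Finset.min'_mem T hT0
  set t₀ := T.min' hT0
  obtain ⟨hI, ht₀⟩ := Finset.mem_filter.1 hmin
  rw [Finset.mem_Icc] at hI
  refine ⟨i₀ + (t₀ : ZMod q), fun s hs => mem_cyclicArc.2 ?_⟩
  obtain ⟨t, h₁, h₂, h⟩ := cycleDist_le_iff.1 (hS _ hi₀ _ hs)
  obtain ⟨r, h₃, h₄, h'⟩ := cycleDist_le_iff.1 (hS _ ht₀ _ hs)
  have hle : t₀ ≤ t := Finset.min'_le _ _ (by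
    rw [hT, Finset.mem_filter, Finset.mem_Icc]
    exact ⟨⟨h₁, h₂⟩, h ▸ hs⟩)
  have heq : ((t : ℤ) : ZMod q) = ((t₀ + r : ℤ) : ZMod q) := by
    have := h.symm.trans h'
    push_cast
    rw [add_assoc] at this
    exact add_left_cancel this
  have := ZMod.eq_of_intCast_eq_of_sub_lt heq (by omega) (by omega)
  exact ⟨r, by omega, h₄, h'⟩

end CyclicDistance

section Levels

variable {V : Type*} {G : SimpleGraph V} {k q : ℕ} {f : ZMod q → V}

theorem IsIsoCycle.neZero (hf : IsIsoCycle G q f) : NeZero q :=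
  ⟨by have := hf.1; omega⟩

theorem IsIsoCycle.dist_le_iff (hf : IsIsoCycle G q f) {i j : ZMod q} {n : ℕ} :
    G.dist (f i) (f j) ≤ n ↔ ∃ t : ℤ, -n ≤ t ∧ t ≤ n ∧ j = i + t := by
  have := hf.neZero
  rw [hf.2, cycleDist_le_iff]

theorem IsIsoCycle.adj_succ (hf : IsIsoCycle G q f) (i : ZMod q) : G.Adj (f i) (f (i + 1)) := by
  have hq := hf.1
  rw [← dist_eq_one_iff_adj]
  have h₁ : G.dist (f i) (f (i + 1)) ≤ 1 := hf.dist_le_iff.2 ⟨1, by simp, by simp, by simp⟩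
  have h₀ : ¬ G.dist (f i) (f (i + 1)) ≤ 0 := by
    intro h
    obtain ⟨t, ht₁, ht₂, ht⟩ := hf.dist_le_iff.1 h
    have h01 : ((1 : ℤ) : ZMod q) = (t : ZMod q) := by
      simpa using ht
    have := ZMod.eq_of_intCast_eq_of_sub_lt h01 (by omega) (by omega)
    omega
  omega

theorem IsIsoCycle.mem_Lpart_self (hf : IsIsoCycle G q f) (i : ZMod q) : f i ∈ Lpart G k f i :=
  ⟨hf.dist_le_iff.2 ⟨k, by omega, by omega, by simp⟩,
    hf.dist_le_iff.2 ⟨-k, by omega, by omega, by simp⟩⟩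

theorem IsIsoCycle.cycleDist_le_of_dist_le_one (hf : IsIsoCycle G q f) (hG : G.Connected)
    (hq : 6 * k + 3 < q) {i j : ZMod q} {v w : V} {e : ℕ} (he : e ≤ 1) (hvw : G.dist v w ≤ e)
    (hv : v ∈ Lpart G k f i) (hw : w ∈ Lpart G k f j) : cycleDist i j ≤ e := by
  have := hf.neZero
  have key : ∀ a b : V, G.dist a v ≤ k → G.dist b w ≤ k → G.dist a b ≤ 2 * k + e := by
    intro a b ha hb
    have h₁ : G.dist a b ≤ G.dist a v + G.dist v b := hG.dist_triangle
    have h₂ : G.dist v b ≤ G.dist v w + G.dist w b := hG.dist_triangle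
    rw [G.dist_comm (u := w)] at h₂
    omega
  obtain ⟨t, ht₁, ht₂, ht⟩ := hf.dist_le_iff.1 (key _ _ hv.1 hw.2)
  obtain ⟨s, hs₁, hs₂, hs⟩ := hf.dist_le_iff.1 (key _ _ hv.2 hw.1)
  obtain ⟨r, hr₁, hr₂, hr⟩ := hf.dist_le_iff.1 (key _ _ hv.1 hw.1)
  have hrt : (r : ZMod q) = ((t - 2 * k : ℤ) : ZMod q) := by
    push_cast
    linear_combination ht - hr
  have hrs : (r : ZMod q) = ((s + 2 * k : ℤ) : ZMod q) := by
    push_cast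
    linear_combination hs - hr
  have h₁ := ZMod.eq_of_intCast_eq_of_sub_lt hrt (by omega) (by omega)
  have h₂ := ZMod.eq_of_intCast_eq_of_sub_lt hrs (by omega) (by omega)
  exact cycleDist_le_iff.2 ⟨r, by omega, by omega, by linear_combination hr⟩

/-- If the parts cover the graph, moving along a walk changes the index of the part by at most
the length of the walk. -/
theorem IsIsoCycle.cycleDist_le_length (hf : IsIsoCycle G q f) (hG : G.Connected)
    (hq : 6 * k + 3 < q) (hcover : ∀ v, ∃ i, v ∈ Lpart G k f i) {i j : ZMod q} {v w : V}
    (p : G.Walk v w) (hv : v ∈ Lpart G k f i) (hw : w ∈ Lpart G k f j) :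
    cycleDist i j ≤ p.length := by
  have := hf.neZero
  induction p generalizing i with
  | nil => exact hf.cycleDist_le_of_dist_le_one hG hq zero_le_one (by simp) hv hw
  | @cons v x w hvx p ih =>
    obtain ⟨m, hm⟩ := hcover x
    obtain ⟨t, ht₁, ht₂, ht⟩ := cycleDist_le_iff.1 (hf.cycleDist_le_of_dist_le_one hG hq le_rfl
      (dist_eq_one_iff_adj.2 hvx).le hv hm)
    obtain ⟨s, hs₁, hs₂, hs⟩ := cycleDist_le_iff.1 (ih hm hw)
    rw [Walk.length_cons]
    exact cycleDist_le_iff.2 ⟨t + s, by push_cast; omega, by push_cast; omega,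
      by push_cast; linear_combination hs + ht⟩

theorem IsIsoCycle.getVert_mem_Lpart (hf : IsIsoCycle G q f) (hG : G.Connected)
    (hq : 6 * k + 3 < q) (hcover : ∀ v, ∃ i, v ∈ Lpart G k f i) {a : ZMod q} {x y : V}
    (p : G.Walk x y) (hx : x ∈ Lpart G k f a) (hy : y ∈ Lpart G k f (a + (p.length : ZMod q)))
    (hp : 2 * p.length < q) {s : ℕ} (hs : s ≤ p.length) :
    p.getVert s ∈ Lpart G k f (a + (s : ZMod q)) := by
  have := hf.neZero
  obtain ⟨m, hm⟩ := hcover (p.getVert s)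
  obtain ⟨t, ht₁, ht₂, ht⟩ :=
    cycleDist_le_iff.1 (hf.cycleDist_le_length hG hq hcover (p.take s) hx hm)
  obtain ⟨r, hr₁, hr₂, hr⟩ :=
    cycleDist_le_iff.1 (hf.cycleDist_le_length hG hq hcover (p.drop s) hm hy)
  rw [Walk.take_length] at ht₁ ht₂
  rw [Walk.drop_length] at hr₁ hr₂
  have h : ((t + r : ℤ) : ZMod q) = ((p.length : ℤ) : ZMod q) := by
    push_cast
    linear_combination - ht - hr
  have := ZMod.eq_of_intCast_eq_of_sub_lt h (by omega) (by omega)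
  have hts : t = s := by omega
  rw [hts] at ht
  push_cast at ht
  exact ht ▸ hm

/-- A closed sequence of adjacent vertices visiting the parts in cyclic order is an isometric
cycle. -/
theorem IsIsoCycle.of_mem_Lpart (hf : IsIsoCycle G q f) (hG : G.Connected)
    (hq : 6 * k + 3 < q) (hcover : ∀ v, ∃ i, v ∈ Lpart G k f i) {h : ZMod q → V}
    (hmem : ∀ j, h j ∈ Lpart G k f j) (hadj : ∀ j, G.Adj (h j) (h (j + 1))) :
    IsIsoCycle G q h := by
  have := hf.neZero
  have hup : ∀ (n : ℕ) (i : ZMod q), G.dist (h i) (h (i + n)) ≤ n := by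
    intro n i
    induction n with
    | zero => simp
    | succ n ih =>
      have h₁ : G.dist (h i) (h (i + (n + 1 : ℕ))) ≤
          G.dist (h i) (h (i + n)) + G.dist (h (i + n)) (h (i + (n + 1 : ℕ))) :=
        hG.dist_triangle
      have h₂ : G.dist (h (i + n)) (h (i + (n + 1 : ℕ))) = 1 := by
        rw [dist_eq_one_iff_adj]
        have := hadj (i + n)
        rwa [add_assoc, ← Nat.cast_succ] at this
      omega
  refine ⟨hf.1, fun i j => le_antisymm ?_ ?_⟩
  · obtain ⟨t, ht₁, ht₂, ht⟩ := cycleDist_le_iff.1 (le_refl (cycleDist i j))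
    rcases le_total 0 t with h0 | h0
    · lift t to ℕ using h0
      have := hup t i
      rw [Int.cast_natCast] at ht
      rw [ht]
      rw [ht] at ht₂
      omega
    · obtain ⟨m, rfl⟩ : ∃ m : ℕ, t = -m := ⟨t.natAbs, by omega⟩
      have hji : i = j + (m : ZMod q) := by
        push_cast at ht
        linear_combination -ht
      have h₁ := hup m j
      rw [← hji, G.dist_comm] at h₁
      omega
  · obtain ⟨p, hp⟩ := hG.exists_walk_length_eq_dist (h i) (h j)
    rw [← hp]
    exact hf.cycleDist_le_length hG hq hcover p (hmem i) (hmem j)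

/-- If the parts of an isometric cycle cover the graph, every vertex lies on an isometric cycle of
the same length. -/
theorem IsIsoCycle.exists_isIsoCycle_mem (hf : IsIsoCycle G q f) (hG : G.Connected)
    (hq : 6 * k + 3 < q) (hcover : ∀ v, ∃ i, v ∈ Lpart G k f i) (v : V) :
    ∃ h : ZMod q → V, IsIsoCycle G q h ∧ ∃ i, h i = v := by
  have := hf.neZero
  obtain ⟨i, hi⟩ := hcover v
  have hdist : G.dist (f (i - k)) v = k ∧ G.dist (f (i + k)) v = k := by
    have h₁ : G.dist (f (i - k)) (f (i + k)) ≤ G.dist (f (i - k)) v + G.dist v (f (i + k)) :=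
      hG.dist_triangle
    have h₂ : G.dist (f (i - k)) v ≤ k := hi.1
    have h₃ : G.dist (f (i + k)) v ≤ k := hi.2
    rw [G.dist_comm (u := v)] at h₁
    obtain ⟨t, ht₁, ht₂, ht⟩ := hf.dist_le_iff.1 h₁
    have h : (t : ZMod q) = ((2 * k : ℤ) : ZMod q) := by
      push_cast
      linear_combination -ht
    have := ZMod.eq_of_intCast_eq_of_sub_lt h (by omega) (by omega)
    omega
  obtain ⟨r, hr⟩ := hG.exists_walk_length_eq_dist (f (i - k)) v
  obtain ⟨p, hp⟩ := hG.exists_walk_length_eq_dist v (f (i + k))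
  rw [hdist.1] at hr
  rw [G.dist_comm, hdist.2] at hp
  let h : ℕ → V := fun s =>
    if s ≤ k then p.getVert s else if s + k ≤ q then f (i + s) else r.getVert (s + k - q)
  have hlow : ∀ s, s ≤ k → h s = p.getVert s := fun s hs => if_pos hs
  have hmid : ∀ s, k ≤ s → s + k ≤ q → h s = f (i + s) := by
    intro s hs hsq
    rcases hs.eq_or_lt with rfl | hs
    · rw [hlow _ le_rfl, p.getVert_of_length_le hp.le]
    · simp only [h]
      rw [if_neg (by omega), if_pos hsq]
  have hhigh : ∀ s, q ≤ s + k → h s = r.getVert (s + k - q) := by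
    intro s hs
    rcases hs.eq_or_lt with hs | hs
    · rw [hmid s (by omega) (by omega), ← hs, Nat.sub_self, r.getVert_zero]
      have : (s : ZMod q) + (k : ZMod q) = 0 := by
        rw [← Nat.cast_add, ← hs, ZMod.natCast_self]
      congr 1
      linear_combination this
    · simp only [h]
      rw [if_neg (by omega), if_neg (by omega)]
  have hadj : ∀ s < q, G.Adj (h s) (h (s + 1)) := by
    intro s hs
    rcases lt_or_ge s k with h₁ | h₁
    · rw [hlow s (by omega), hlow (s + 1) (by omega)]
      exact p.adj_getVert_succ (by omega)
    rcases lt_or_ge (s + k) q with h₂ | h₂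
    · rw [hmid s (by omega) (by omega), hmid (s + 1) (by omega) (by omega)]
      have := hf.adj_succ (i + s)
      rwa [add_assoc, ← Nat.cast_succ] at this
    · rw [hhigh s (by omega), hhigh (s + 1) (by omega),
        show s + 1 + k - q = s + k - q + 1 by omega]
      exact r.adj_getVert_succ (by omega)
  have hmem : ∀ s < q, h s ∈ Lpart G k f (i + s) := by
    intro s hs
    rcases lt_or_ge s k with h₁ | h₁
    · rw [hlow s (by omega)]
      exact hf.getVert_mem_Lpart hG hq hcover p hi (hp.symm ▸ hf.mem_Lpart_self _) (by omega)
        (by omega)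
    rcases lt_or_ge (s + k) q with h₂ | h₂
    · rw [hmid s (by omega) (by omega)]
      exact hf.mem_Lpart_self _
    · rw [hhigh s h₂]
      have := hf.getVert_mem_Lpart hG hq hcover r (hf.mem_Lpart_self _)
        (by rwa [hr, sub_add_cancel]) (by omega) (s := s + k - q) (by omega)
      have hcast : i - (k : ZMod q) + ((s + k - q : ℕ) : ZMod q) = i + s := by
        rw [Nat.cast_sub h₂, Nat.cast_add, ZMod.natCast_self]
        ring
      rwa [hcast] at this
  have hper : h q = h 0 := by
    rw [hhigh q (by omega), hlow 0 (by omega), Nat.add_sub_cancel_left,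
      r.getVert_of_length_le hr.le, p.getVert_zero]
  refine ⟨fun j => h (j - i).val, hf.of_mem_Lpart hG hq hcover ?_ ?_, i, ?_⟩
  · intro j
    have := hmem (j - i).val (ZMod.val_lt _)
    rwa [ZMod.natCast_zmod_val, add_sub_cancel] at this
  · intro j
    have hlt := ZMod.val_lt (j - i)
    have hsucc : h (j + 1 - i).val = h ((j - i).val + 1) := by
      have hcast : j + 1 - i = (((j - i).val + 1 : ℕ) : ZMod q) := by
        push_cast
        rw [ZMod.natCast_zmod_val]
        ring
      rw [hcast, ZMod.val_natCast]
      rcases (Nat.succ_le_of_lt hlt).eq_or_lt with heq | hlt'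
      · rw [Nat.succ_eq_add_one] at heq
        rw [heq, Nat.mod_self, hper]
      · rw [Nat.mod_eq_of_lt hlt']
    simp only [hsucc]
    exact hadj _ hlt
  · simp [hlow 0 (by omega)]

end Levels

section Counting

/-- Double counting with equality: if every set has at least `M` elements, every element lies in
at most `g` sets, and both bounds give the same number of incidences, then both are attained. -/
theorem ncard_eq_of_incidence_bounds {ι V : Type*} [Fintype ι] [Fintype V] {A : ι → Set V}
    {M g : ℕ} (hA : ∀ i, M ≤ (A i).ncard) (hV : ∀ v, {i | v ∈ A i}.ncard ≤ g)
    (h : g * Fintype.card V = Fintype.card ι * M) :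
    (∀ i, (A i).ncard = M) ∧ ∀ v, {i | v ∈ A i}.ncard = g := by
  classical
  have hcount : ∑ i, (A i).ncard = ∑ v, {i | v ∈ A i}.ncard := by
    simp only [Set.ncard_eq_toFinset_card']
    convert Finset.sum_card_bipartiteAbove_eq_sum_card_bipartiteBelow
      (s := Finset.univ) (t := Finset.univ) (fun (i : ι) (v : V) => v ∈ A i) using 3
    · ext; simp [Finset.bipartiteAbove]
    · ext; simp [Finset.bipartiteBelow]
  have h₁ : ∑ _i : ι, M ≤ ∑ i, (A i).ncard := Finset.sum_le_sum fun i _ => hA i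
  have h₂ : ∑ v, {i | v ∈ A i}.ncard ≤ ∑ _v : V, g := Finset.sum_le_sum fun v _ => hV v
  have hconst : ∑ _i : ι, M = ∑ _v : V, g := by
    simp only [Finset.sum_const, Finset.card_univ, smul_eq_mul]
    rw [← h, mul_comm]
  constructor
  · intro i
    exact ((Finset.sum_eq_sum_iff_of_le fun i _ => hA i).1 (by omega) i (Finset.mem_univ i)).symm
  · intro v
    exact (Finset.sum_eq_sum_iff_of_le fun v _ => hV v).1 (by omega) v (Finset.mem_univ v)

variable {V : Type*} {G : SimpleGraph V} {δ k q : ℕ} {f : ZMod q → V}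

theorem IsIsoCycle.exists_subset_cyclicArc_disk (hf : IsIsoCycle G q f) (hG : G.Connected)
    (hq : 6 * k + 3 < q) (v : V) : ∃ a, {i | v ∈ disk G k (f i)} ⊆ cyclicArc a (2 * k) := by
  have := hf.neZero
  refine exists_subset_cyclicArc (by omega) fun i hi j hj => ?_
  rw [← hf.2]
  have h₁ : G.dist (f i) (f j) ≤ G.dist (f i) v + G.dist v (f j) := hG.dist_triangle
  have h₂ : G.dist (f i) v ≤ k := hi
  have h₃ : G.dist (f j) v ≤ k := hj
  rw [G.dist_comm (u := v)] at h₁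
  omega

theorem mem_Lpart_of_mem_disk {v : V} {a : ZMod q} (h₁ : v ∈ disk G k (f a))
    (h₂ : v ∈ disk G k (f (a + (2 * k : ℕ)))) : v ∈ Lpart G k f (a + k) := by
  refine ⟨?_, ?_⟩
  · rwa [add_sub_cancel_right]
  · rwa [add_assoc, ← Nat.cast_add, ← two_mul]

theorem IsIsoCycle.extremal_of_girth_odd [Fintype V] (hf : IsIsoCycle G q f) (hG : G.Connected)
    (hδ : ∀ v, δ ≤ ndeg G v) (hk : 1 ≤ k) (hg : G.girth = 2 * k + 1) (hq : 6 * k + 3 < q)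
    (hcard : (2 * k + 1) * Fintype.card V = q * (1 + δ * ∑ i ∈ Finset.range k, (δ - 1) ^ i)) :
    (∀ i, ndeg G (f i) ≤ δ) ∧ ∀ v, ∃ i, v ∈ Lpart G k f i := by
  have := hf.neZero
  have hmoore := hG.moore_le_ncard_disk hδ (k := k) (by omega)
  have harc := hf.exists_subset_cyclicArc_disk hG hq
  obtain ⟨hA, hV⟩ := ncard_eq_of_incidence_bounds (A := fun i => disk G k (f i))
    (M := 1 + δ * ∑ i ∈ Finset.range k, (δ - 1) ^ i) (g := 2 * k + 1)
    (fun i => (Nat.add_le_add_left (Nat.mul_le_mul_right _ (hδ _)) 1).trans (hmoore (f i)))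
    (fun v => by
      obtain ⟨a, ha⟩ := harc v
      exact (Set.ncard_le_ncard ha (finite_cyclicArc _ _)).trans (ncard_cyclicArc_le _ _))
    (by rw [ZMod.card]; exact hcard)
  constructor
  · intro i
    have h₁ := hmoore (f i)
    rw [hA i] at h₁
    have hpos : 0 < ∑ i ∈ Finset.range k, (δ - 1) ^ i :=
      Finset.sum_pos' (fun _ _ => Nat.zero_le _) ⟨0, Finset.mem_range.2 (by omega), by simp⟩
    exact Nat.le_of_mul_le_mul_right (Nat.le_of_add_le_add_left h₁) hpos
  · intro v
    obtain ⟨a, ha⟩ := harc v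
    have heq := Set.eq_of_subset_of_ncard_le ha
      ((ncard_cyclicArc_le _ _).trans (hV v).ge) (finite_cyclicArc _ _)
    refine ⟨a + k, mem_Lpart_of_mem_disk ?_ ?_⟩
    · exact heq.ge (mem_cyclicArc.2 ⟨0, by omega, by omega, by simp⟩)
    · exact heq.ge (mem_cyclicArc.2 ⟨2 * k, by omega, by omega, by simp⟩)

theorem IsIsoCycle.extremal_of_girth_even [Fintype V] (hf : IsIsoCycle G q f) (hG : G.Connected)
    (hδ : ∀ v, δ ≤ ndeg G v) (hk : 1 ≤ k) (hg : G.girth = 2 * k + 2) (hq : 6 * k + 3 < q)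
    (hcard : (2 * k + 2) * Fintype.card V =
      q * (2 + ((δ - 1) + (δ - 1)) * ∑ i ∈ Finset.range k, (δ - 1) ^ i)) :
    (∀ i, ndeg G (f i) - 1 ≤ δ - 1) ∧ ∀ v, ∃ i, v ∈ Lpart G k f i := by
  have := hf.neZero
  have hmoore := fun i => hG.moore_le_ncard_edisk hδ (k := k) (by omega) (hf.adj_succ i)
  have hδ' : ∀ v, δ - 1 ≤ ndeg G v - 1 := fun v => Nat.sub_le_sub_right (hδ v) 1
  have harc : ∀ v, ∃ a, {i | v ∈ disk G k (f i)} ⊆ cyclicArc a (2 * k) ∧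
      {i | v ∈ edisk G k (f i) (f (i + 1))} ⊆ cyclicArc (a - 1) (2 * k + 1) := by
    intro v
    obtain ⟨a, ha⟩ := hf.exists_subset_cyclicArc_disk hG hq v
    refine ⟨a, ha, ?_⟩
    rintro i (hi | hi)
    · obtain ⟨r, h₁, h₂, h⟩ := mem_cyclicArc.1 (ha hi)
      refine mem_cyclicArc.2 ⟨r + 1, by omega, by omega, ?_⟩
      push_cast
      linear_combination h
    · obtain ⟨r, h₁, h₂, h⟩ := mem_cyclicArc.1 (ha (show i + 1 ∈ _ from hi))
      refine mem_cyclicArc.2 ⟨r, by omega, by omega, ?_⟩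
      linear_combination h
  obtain ⟨hA, hV⟩ := ncard_eq_of_incidence_bounds (A := fun i => edisk G k (f i) (f (i + 1)))
    (M := 2 + ((δ - 1) + (δ - 1)) * ∑ i ∈ Finset.range k, (δ - 1) ^ i) (g := 2 * k + 2)
    (fun i => (Nat.add_le_add_left (Nat.mul_le_mul_right _
      (Nat.add_le_add (hδ' _) (hδ' _))) 2).trans (hmoore i))
    (fun v => by
      obtain ⟨a, _, ha⟩ := harc v
      exact (Set.ncard_le_ncard ha (finite_cyclicArc _ _)).trans (ncard_cyclicArc_le _ _))
    (by rw [ZMod.card]; exact hcard)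
  constructor
  · intro i
    have h₁ := hmoore i
    rw [hA i] at h₁
    have hpos : 0 < ∑ i ∈ Finset.range k, (δ - 1) ^ i :=
      Finset.sum_pos' (fun _ _ => Nat.zero_le _) ⟨0, Finset.mem_range.2 (by omega), by simp⟩
    have h₂ := Nat.le_of_mul_le_mul_right (Nat.le_of_add_le_add_left h₁) hpos
    have h₃ := hδ' (f (i + 1))
    omega
  · intro v
    obtain ⟨a, ha, ha'⟩ := harc v
    have heq := Set.eq_of_subset_of_ncard_le ha'
      ((ncard_cyclicArc_le _ _).trans (hV v).ge) (finite_cyclicArc _ _)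
    refine ⟨a + k, mem_Lpart_of_mem_disk ?_ ?_⟩
    · have : a - 1 ∈ {i | v ∈ edisk G k (f i) (f (i + 1))} :=
        heq.ge (mem_cyclicArc.2 ⟨0, by omega, by omega, by simp⟩)
      rcases this with h | h
      · obtain ⟨r, h₁, h₂, h⟩ := mem_cyclicArc.1 (ha h)
        have hr : ((-1 : ℤ) : ZMod q) = (r : ZMod q) := by
          push_cast
          linear_combination h
        have := ZMod.eq_of_intCast_eq_of_sub_lt hr (by omega) (by omega)
        omega
      · rwa [sub_add_cancel] at h
    · have : a + (2 * k : ℕ) ∈ {i | v ∈ edisk G k (f i) (f (i + 1))} :=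
        heq.ge (mem_cyclicArc.2 ⟨2 * k + 1, by omega, by omega, by push_cast; ring⟩)
      rcases this with h | h
      · exact h
      · obtain ⟨r, h₁, h₂, h⟩ := mem_cyclicArc.1 (ha h)
        have hr : ((2 * k + 1 : ℤ) : ZMod q) = (r : ZMod q) := by
          push_cast at h ⊢
          linear_combination h
        have := ZMod.eq_of_intCast_eq_of_sub_lt hr (by omega) (by omega)
        omega

theorem IsIsoCycle.one_le_ndeg [Finite V] (hf : IsIsoCycle G q f) (i : ZMod q) :
    1 ≤ ndeg G (f i) :=
  (Set.ncard_pos (Set.toFinite _)).2 ⟨f (i + 1), hf.adj_succ i⟩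

end Counting

/-- Proposition 5.7: every equatorial graph is regular. -/
theorem stmt_12 {V : Type*} (G : SimpleGraph V) (δ g q : ℕ)
    (hG : IsEquatorial G δ g q) :
    ∀ v : V, ndeg G v = δ := by
  obtain ⟨hfin, hconn, hgirth, ⟨hδ, v₀, hv₀⟩, ⟨hiso, -⟩, hq, hcard⟩ := hG
  have := Fintype.ofFinite V
  obtain ⟨f, hf⟩ : HasIsoCycle G q := hiso.resolve_right fun h => by omega
  have hg3 : 3 ≤ g := by
    rw [← hgirth]
    refine three_le_girth fun hac => ?_
    have hg0 : g = 0 := hgirth.symm.trans (girth_eq_zero.2 hac)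
    subst hg0
    have hpos : 0 < q * mooreBound δ 0 := Nat.mul_pos (by omega) (by simp [mooreBound])
    omega
  have hk : 1 ≤ (g + 1) / 2 - 1 := by omega
  rw [Nat.card_eq_fintype_card] at hcard
  unfold mooreBound at hcard
  set k := (g + 1) / 2 - 1 with hkdef
  rcases Nat.even_or_odd g with heven | hodd
  · rw [if_neg (Nat.not_odd_iff_even.2 heven)] at hcard
    obtain ⟨m, hm⟩ := heven
    have hgk : g = 2 * k + 2 := by omega
    have hsum : ∑ i ∈ Finset.Icc 1 k, 2 * (δ - 1) ^ i =
        ((δ - 1) + (δ - 1)) * ∑ i ∈ Finset.range k, (δ - 1) ^ i := by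
      rw [← Finset.Ico_add_one_right_eq_Icc, Finset.sum_Ico_eq_sum_range, Finset.mul_sum]
      exact Finset.sum_congr rfl fun i _ => by rw [pow_add]; ring
    rw [hsum, hgk] at hcard
    have hext : ∀ {h : ZMod q → V}, IsIsoCycle G q h →
        (∀ i, ndeg G (h i) - 1 ≤ δ - 1) ∧ ∀ v, ∃ i, v ∈ Lpart G k h i := fun hh =>
      hh.extremal_of_girth_even hconn hδ hk (hgirth.trans hgk) hq hcard
    have hdeg : ∀ v, 1 ≤ ndeg G v ∧ ndeg G v - 1 ≤ δ - 1 := by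
      intro v
      obtain ⟨h, hh, i, rfl⟩ := hf.exists_isIsoCycle_mem hconn hq (hext hf).2 v
      exact ⟨hh.one_le_ndeg i, (hext hh).1 i⟩
    intro v
    have h₁ := hδ v
    have h₂ := hdeg v
    have h₃ := hdeg v₀
    omega
  · rw [if_pos hodd] at hcard
    obtain ⟨m, hm⟩ := hodd
    have hgk : g = 2 * k + 1 := by omega
    rw [hgk] at hcard
    have hext : ∀ {h : ZMod q → V}, IsIsoCycle G q h →
        (∀ i, ndeg G (h i) ≤ δ) ∧ ∀ v, ∃ i, v ∈ Lpart G k h i := fun hh =>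
      hh.extremal_of_girth_odd hconn hδ hk (hgirth.trans hgk) hq hcard
    intro v
    obtain ⟨h, hh, i, rfl⟩ := hf.exists_isIsoCycle_mem hconn hq (hext hf).2 v
    exact le_antisymm ((hext hh).1 i) (hδ _)
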